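/- Slepian–Wolf theorem (achievability part): Let (A, B) be a pair of statistically dependent random variables taking values in finite alphabets, and let (A_1, B_1), (A_2, B_2), ... be i.i.d. copies of (A, B). Every rate pair (R_A, R_B) satisfying the strict inequalities R_A > H(A|B), R_B > H(B|A), and R_A + R_B > H(A, B) is achievable for lossless distributed compression: for every ε > 0 there exist a block length n, separate encoders f_A : 𝒜^n → {1, ..., ⌈2^{nR_A}⌉} and f_B : ℬ^n → {1, ..., ⌈2^{nR_B}⌉}, and a joint decoder g such that the probability that g(f_A(A^n), f_B(B^n)) ≠ (A^n, B^n) is at most ε. -/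

import Mathlib

/-!
Slepian–Wolf theorem, converse part.

We model a pair of correlated sources by a joint probability mass function
`p : α × β → ℝ` on finite alphabets.  The i.i.d. source sequence of block
length `n` is modeled by the product weights `∏ i, p (s i)` on
`Fin n → α × β`.  Entropies are measured in bits (logarithm base 2).
-/

open scoped BigOperators

/-- Shannon entropy (in bits) of a finitely supported distribution. -/
noncomputable def shannonEntropy {γ : Type*} [Fintype γ] (p : γ → ℝ) : ℝ :=
  -∑ x, p x * Real.logb 2 (p x)

/-- Marginal distribution of the first component. -/
noncomputable def fstMarginal {α β : Type*} [Fintype α] [Fintype β]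
    (p : α × β → ℝ) : α → ℝ :=
  fun a => ∑ b, p (a, b)

/-- Marginal distribution of the second component. -/
noncomputable def sndMarginal {α β : Type*} [Fintype α] [Fintype β]
    (p : α × β → ℝ) : β → ℝ :=
  fun b => ∑ a, p (a, b)

/-- Conditional entropy `H(A|B) = H(A,B) - H(B)` (in bits) of the first
component given the second, for a joint distribution `p` of `(A, B)`. -/
noncomputable def condEntropyFst {α β : Type*} [Fintype α] [Fintype β]
    (p : α × β → ℝ) : ℝ :=
  shannonEntropy p - shannonEntropy (sndMarginal p)

/-- Conditional entropy `H(B|A) = H(A,B) - H(A)` (in bits) of the second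
component given the first, for a joint distribution `p` of `(A, B)`. -/
noncomputable def condEntropySnd {α β : Type*} [Fintype α] [Fintype β]
    (p : α × β → ℝ) : ℝ :=
  shannonEntropy p - shannonEntropy (fstMarginal p)

/-- Probability of the i.i.d. block `s` under the per-symbol distribution `p`. -/
noncomputable def iidProb {γ : Type*} (p : γ → ℝ) {n : ℕ} (s : Fin n → γ) : ℝ :=
  ∏ i, p (s i)

/-- Block error probability of a Slepian–Wolf code consisting of separate
encoders `fA`, `fB` and a joint decoder `g`, for the i.i.d. source with
per-symbol joint distribution `p`: the probability that the decoded pair of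
sequences differs from the true pair `(A^n, B^n)`. -/
noncomputable def swErrorProb {α β : Type*} [Fintype α] [Fintype β]
    [DecidableEq α] [DecidableEq β] (p : α × β → ℝ) {n MA MB : ℕ}
    (fA : (Fin n → α) → Fin MA) (fB : (Fin n → β) → Fin MB)
    (g : Fin MA × Fin MB → (Fin n → α) × (Fin n → β)) : ℝ :=
  ∑ s : Fin n → α × β,
    if g (fA fun i => (s i).1, fB fun i => (s i).2)
        ≠ ((fun i => (s i).1), (fun i => (s i).2)) then iidProb p s else 0

/-- The rate pair `(RA, RB)` is achievable for lossless distributed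
compression of the i.i.d. source with per-symbol joint distribution `p`:
for every `ε > 0` there exist a block length `n ≥ 1`, separate encoders
`fA : αⁿ → {1, …, ⌈2^{n RA}⌉}` and `fB : βⁿ → {1, …, ⌈2^{n RB}⌉}`, and a
joint decoder `g` whose block error probability is at most `ε`. -/
def SWAchievable {α β : Type*} [Fintype α] [Fintype β]
    [DecidableEq α] [DecidableEq β] (p : α × β → ℝ) (RA RB : ℝ) : Prop :=
  ∀ ε : ℝ, 0 < ε → ∃ n : ℕ, 0 < n ∧
    ∃ (fA : (Fin n → α) → Fin ⌈(2 : ℝ) ^ ((n : ℝ) * RA)⌉₊)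
      (fB : (Fin n → β) → Fin ⌈(2 : ℝ) ^ ((n : ℝ) * RB)⌉₊)
      (g : Fin ⌈(2 : ℝ) ^ ((n : ℝ) * RA)⌉₊ × Fin ⌈(2 : ℝ) ^ ((n : ℝ) * RB)⌉₊ →
        (Fin n → α) × (Fin n → β)),
      swErrorProb p fA fB g ≤ ε


theorem sum_collision_le {A : Type*} [Fintype A] [DecidableEq A] {M : ℕ} (hM : 0 < M)
    (x x' : A) :
    ∑ f : A → Fin M, (if f x = f x' then 1 else 0 : ℝ) ≤
      Fintype.card (A → Fin M) * ((if x = x' then 1 else 0) + 1 / (M : ℝ)) := by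
  have hM' : (0 : ℝ) < M := by exact_mod_cast hM
  by_cases h : x = x'
  · subst h
    simp only [if_true, Finset.sum_const, Finset.card_univ, nsmul_eq_mul, mul_one]
    have : (0 : ℝ) ≤ Fintype.card (A → Fin M) * (1 / (M : ℝ)) := by positivity
    linarith
  · have e1 : ∑ f : A → Fin M, (if f x = f x' then 1 else 0 : ℝ) =
        Fintype.card ({j // j ≠ x} → Fin M) := by
      rw [Fintype.sum_equiv (Equiv.funSplitAt x (Fin M)) _
        (fun z => if z.1 = z.2 ⟨x', Ne.symm h⟩ then (1 : ℝ) else 0)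
        (fun f => by simp [Equiv.funSplitAt]), Fintype.sum_prod_type_right]
      simp
    have e2 : Fintype.card (A → Fin M) = M * Fintype.card ({j // j ≠ x} → Fin M) := by
      rw [Fintype.card_congr (Equiv.funSplitAt x (Fin M)), Fintype.card_prod, Fintype.card_fin]
    rw [e1, e2, if_neg h]
    push_cast
    field_simp
    simp

theorem exists_binning_collision_le {A B : Type*} [Fintype A] [Fintype B]
    [DecidableEq A] [DecidableEq B] (P : A × B → ℝ) (hP : ∀ z, 0 ≤ P z)
    (T : Finset (A × B)) {MA MB : ℕ} (hMA : 0 < MA) (hMB : 0 < MB) {KA KB K : ℝ}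
    (hKA : ∀ y, ((Finset.univ.filter fun x => (x, y) ∈ T).card : ℝ) ≤ KA)
    (hKB : ∀ x, ((Finset.univ.filter fun y => (x, y) ∈ T).card : ℝ) ≤ KB)
    (hK : (T.card : ℝ) ≤ K) :
    ∃ (fA : A → Fin MA) (fB : B → Fin MB),
      ∑ z, P z * ∑ w ∈ T,
          (if w ≠ z ∧ fA w.1 = fA z.1 ∧ fB w.2 = fB z.2 then 1 else 0 : ℝ) ≤
        (∑ z, P z) * (KA / MA + KB / MB + K / (MA * MB)) := by
  have : NeZero MA := ⟨hMA.ne'⟩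
  have : NeZero MB := ⟨hMB.ne'⟩
  have hMA' : (0 : ℝ) < MA := by exact_mod_cast hMA
  have hMB' : (0 : ℝ) < MB := by exact_mod_cast hMB
  set NA : ℝ := (Fintype.card (A → Fin MA) : ℝ) with hNA
  set NB : ℝ := (Fintype.card (B → Fin MB) : ℝ) with hNB
  have hpair (z w : A × B) :
      ∑ f : (A → Fin MA) × (B → Fin MB),
        (if w ≠ z ∧ f.1 w.1 = f.1 z.1 ∧ f.2 w.2 = f.2 z.2 then 1 else 0 : ℝ) ≤
      NA * NB * ((if w.2 = z.2 then 1 else 0) / MA + (if w.1 = z.1 then 1 else 0) / MB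
        + 1 / (MA * MB)) := by
    by_cases hwz : w = z
    · simp only [hwz, ne_eq, not_true_eq_false, false_and, if_false, Finset.sum_const_zero]
      positivity
    · have hA := sum_collision_le hMA w.1 z.1
      have hB := sum_collision_le hMB w.2 z.2
      calc _ = (∑ f : A → Fin MA, (if f w.1 = f z.1 then 1 else 0 : ℝ)) *
            ∑ f : B → Fin MB, (if f w.2 = f z.2 then 1 else 0 : ℝ) := by
            rw [Fintype.sum_mul_sum, Fintype.sum_prod_type]
            refine Finset.sum_congr rfl fun f _ => Finset.sum_congr rfl fun g _ => ?_
            by_cases h1 : f w.1 = f z.1 <;> by_cases h2 : g w.2 = g z.2 <;> simp [hwz, h1, h2]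
        _ ≤ (NA * ((if w.1 = z.1 then 1 else 0) + 1 / (MA : ℝ))) *
            (NB * ((if w.2 = z.2 then 1 else 0) + 1 / (MB : ℝ))) := by
            refine mul_le_mul hA hB (Finset.sum_nonneg fun _ _ => ?_) (by positivity)
            positivity
        _ = _ := by
            have : ¬ (w.1 = z.1 ∧ w.2 = z.2) := fun h => hwz (Prod.ext h.1 h.2)
            by_cases h1 : w.1 = z.1
            · have h2 : w.2 ≠ z.2 := fun h => this ⟨h1, h⟩
              simp only [h1, h2, if_true, if_false]
              field_simp
              ring
            · simp only [h1, if_false]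
              split_ifs <;> field_simp <;> ring
  have hT (z : A × B) :
      ∑ w ∈ T, ∑ f : (A → Fin MA) × (B → Fin MB),
        (if w ≠ z ∧ f.1 w.1 = f.1 z.1 ∧ f.2 w.2 = f.2 z.2 then 1 else 0 : ℝ) ≤
      NA * NB * (KA / MA + KB / MB + K / (MA * MB)) := by
    have cA : ∑ w ∈ T, (if w.2 = z.2 then 1 else 0 : ℝ) ≤ KA := by
      refine le_trans (le_of_eq ?_) (hKA z.2)
      rw [Finset.sum_boole]
      congr 1
      refine Finset.card_bij (fun w _ => w.1) ?_ ?_ ?_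
      · rintro ⟨a, b⟩ h
        simp only [Finset.mem_filter] at h
        simp [← h.2, h.1]
      · rintro ⟨a, b⟩ h ⟨a', b'⟩ h' e
        simp only [Finset.mem_filter] at h h'
        exact Prod.ext e (h.2.trans h'.2.symm)
      · intro a h
        exact ⟨(a, z.2), by simpa using h, rfl⟩
    have cB : ∑ w ∈ T, (if w.1 = z.1 then 1 else 0 : ℝ) ≤ KB := by
      refine le_trans (le_of_eq ?_) (hKB z.1)
      rw [Finset.sum_boole]
      congr 1
      refine Finset.card_bij (fun w _ => w.2) ?_ ?_ ?_
      · rintro ⟨a, b⟩ h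
        simp only [Finset.mem_filter] at h
        simp [← h.2, h.1]
      · rintro ⟨a, b⟩ h ⟨a', b'⟩ h' e
        simp only [Finset.mem_filter] at h h'
        exact Prod.ext (h.2.trans h'.2.symm) e
      · intro b h
        exact ⟨(z.1, b), by simpa using h, rfl⟩
    refine (Finset.sum_le_sum fun w _ => hpair z w).trans ?_
    rw [← Finset.mul_sum, Finset.sum_add_distrib, Finset.sum_add_distrib, ← Finset.sum_div,
      ← Finset.sum_div, Finset.sum_const, nsmul_eq_mul, mul_one_div]
    gcongr
  suffices h : ∃ f ∈ (Finset.univ : Finset ((A → Fin MA) × (B → Fin MB))),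
      ∑ z, P z * ∑ w ∈ T,
          (if w ≠ z ∧ f.1 w.1 = f.1 z.1 ∧ f.2 w.2 = f.2 z.2 then 1 else 0 : ℝ) ≤
        (∑ z, P z) * (KA / MA + KB / MB + K / (MA * MB)) by
    obtain ⟨f, -, hf⟩ := h
    exact ⟨f.1, f.2, hf⟩
  refine Finset.exists_le_of_sum_le Finset.univ_nonempty ?_
  rw [Finset.sum_comm, Finset.sum_const, nsmul_eq_mul, Finset.card_univ, Fintype.card_prod,
    Nat.cast_mul, ← hNA, ← hNB, Finset.sum_mul, Finset.mul_sum]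
  refine Finset.sum_le_sum fun z _ => ?_
  rw [← Finset.mul_sum, Finset.sum_comm, mul_left_comm]
  exact mul_le_mul_of_nonneg_left (hT z) (hP z)

theorem exists_binning_code_error_le {A B : Type*} [Fintype A] [Fintype B]
    [DecidableEq A] [DecidableEq B] [Nonempty (A × B)] (P : A × B → ℝ) (hP : ∀ z, 0 ≤ P z)
    (T : Finset (A × B)) {MA MB : ℕ} (hMA : 0 < MA) (hMB : 0 < MB) {KA KB K : ℝ}
    (hKA : ∀ y, ((Finset.univ.filter fun x => (x, y) ∈ T).card : ℝ) ≤ KA)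
    (hKB : ∀ x, ((Finset.univ.filter fun y => (x, y) ∈ T).card : ℝ) ≤ KB)
    (hK : (T.card : ℝ) ≤ K) :
    ∃ (fA : A → Fin MA) (fB : B → Fin MB) (g : Fin MA × Fin MB → A × B),
      ∑ z, (if g (fA z.1, fB z.2) ≠ z then P z else 0) ≤
        ∑ z, (if z ∉ T then P z else 0) +
          (∑ z, P z) * (KA / MA + KB / MB + K / (MA * MB)) := by
  classical
  obtain ⟨fA, fB, h⟩ := exists_binning_collision_le P hP T hMA hMB hKA hKB hK
  refine ⟨fA, fB, fun m => if hm : ∃ w ∈ T, (fA w.1, fB w.2) = m then hm.choose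
    else Classical.arbitrary _, ?_⟩
  refine le_trans ?_ (add_le_add_right h _)
  rw [← Finset.sum_add_distrib]
  refine Finset.sum_le_sum fun z _ => ?_
  have hnn (w : A × B) :
      (0 : ℝ) ≤ if w ≠ z ∧ fA w.1 = fA z.1 ∧ fB w.2 = fB z.2 then 1 else 0 := by
    positivity
  by_cases hz : z ∈ T
  · have hm : ∃ w ∈ T, (fA w.1, fB w.2) = (fA z.1, fB z.2) := ⟨z, hz, rfl⟩
    simp only [dif_pos hm, hz, not_true_eq_false, if_false, zero_add]
    split_ifs with hne
    · refine le_mul_of_one_le_right (hP z) ?_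
      refine le_trans (le_of_eq ?_) (Finset.single_le_sum (fun w _ => hnn w) hm.choose_spec.1)
      have := Prod.mk.inj hm.choose_spec.2
      rw [if_pos ⟨hne, this⟩]
    · exact mul_nonneg (hP z) (Finset.sum_nonneg fun w _ => hnn w)
  · rw [if_pos hz]
    have := mul_nonneg (hP z) (Finset.sum_nonneg fun w (_ : w ∈ T) => hnn w)
    split_ifs <;> linarith [hP z]

/-- Chernoff bound. -/
theorem exists_sum_iid_lt_le_pow {γ : Type*} [Fintype γ] (p q : γ → ℝ) (hp0 : ∀ x, 0 ≤ p x)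
    (hp1 : ∑ x, p x = 1) (hq : ∀ x, 0 < p x → 0 < q x) {c : ℝ} (hc : 0 < c)
    (h : ∑ x, p x * Real.log (c * q x / p x) < 0) :
    ∃ ρ : ℝ, 0 ≤ ρ ∧ ρ < 1 ∧ ∀ n : ℕ,
      ∑ s : Fin n → γ, (if ∏ i, p (s i) < c ^ n * ∏ i, q (s i) then ∏ i, p (s i) else 0) ≤
        ρ ^ n := by
  set φ : ℝ → ℝ := fun t => ∑ x, p x * (c * q x / p x) ^ t with hφ
  have hφ0 : φ 0 = 1 := by simp [hφ, hp1]
  have hpos (x : γ) (hx : 0 < p x) : 0 < c * q x / p x := by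
    have := hq x hx
    positivity
  have hder : HasDerivAt φ (∑ x, p x * Real.log (c * q x / p x)) 0 := by
    refine HasDerivAt.fun_sum fun x _ => ?_
    rcases (hp0 x).eq_or_lt with hx | hx
    · simpa [← hx] using hasDerivAt_const (0 : ℝ) (0 : ℝ)
    · simpa using ((Real.hasStrictDerivAt_const_rpow (hpos x hx) 0).hasDerivAt).const_mul (p x)
  obtain ⟨t, ht0, ht⟩ : ∃ t, 0 < t ∧ φ t < 1 := by
    have hslope : ∀ᶠ t in nhdsWithin (0 : ℝ) (Set.Ioi 0), slope φ 0 t < 0 :=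
      ((hasDerivAt_iff_tendsto_slope.1 hder).mono_left
        (nhdsWithin_mono _ fun _ ht => ne_of_gt ht)).eventually_lt_const h
    obtain ⟨t, hst, ht⟩ := (hslope.and self_mem_nhdsWithin).exists
    rw [slope_def_field, hφ0, sub_zero, div_lt_iff₀ ht, zero_mul, sub_neg] at hst
    exact ⟨t, ht, hst⟩
  refine ⟨φ t, ?_, ht, fun n => ?_⟩
  · refine Finset.sum_nonneg fun x _ => ?_
    rcases (hp0 x).eq_or_lt with hx | hx
    · simp [← hx]
    · exact mul_nonneg hx.le (Real.rpow_nonneg (hpos x hx).le _)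
  · rw [hφ, Fintype.sum_pow]
    refine Finset.sum_le_sum fun s _ => ?_
    by_cases hs : ∃ i, p (s i) = 0
    · obtain ⟨i, hi⟩ := hs
      have h0 : ∏ i, p (s i) = 0 := Finset.prod_eq_zero (Finset.mem_univ i) hi
      rw [Finset.prod_mul_distrib, h0]
      simp
    · push Not at hs
      have hs' (i : Fin n) : 0 < p (s i) := (hp0 _).lt_of_ne' (hs i)
      have hP : 0 < ∏ i, p (s i) := Finset.prod_pos fun i _ => hs' i
      rw [Finset.prod_mul_distrib, Real.finsetProd_rpow _ _ fun i _ => (hpos _ (hs' i)).le,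
        Finset.prod_div_distrib, Finset.prod_mul_distrib, Finset.prod_const, Finset.card_univ,
        Fintype.card_fin]
      split_ifs with hlt
      · refine le_mul_of_one_le_right hP.le (Real.one_le_rpow ?_ ht0.le)
        rw [one_le_div hP]
        exact hlt.le
      · have : 0 < ∏ i, q (s i) := Finset.prod_pos fun i _ => hq _ (hs' i)
        positivity

theorem tendsto_sum_iid_lt_zero {γ : Type*} [Fintype γ] (p q : γ → ℝ) (hp0 : ∀ x, 0 ≤ p x)
    (hp1 : ∑ x, p x = 1) (hq : ∀ x, 0 < p x → 0 < q x) {r : ℝ}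
    (h : shannonEntropy p + ∑ x, p x * Real.logb 2 (q x) < r) :
    Filter.Tendsto (fun n : ℕ => ∑ s : Fin n → γ,
      (if ∏ i, p (s i) < ((2 : ℝ) ^ (-r)) ^ n * ∏ i, q (s i) then ∏ i, p (s i) else 0))
      Filter.atTop (nhds 0) := by
  have hlog : ∑ x, p x * Real.log ((2 : ℝ) ^ (-r) * q x / p x) =
      Real.log 2 * (shannonEntropy p + ∑ x, p x * Real.logb 2 (q x) - r) := by
    have hr : r = ∑ x, p x * r := by rw [← Finset.sum_mul, hp1, one_mul]
    conv_rhs => rw [hr]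
    rw [shannonEntropy, ← Finset.sum_neg_distrib, ← Finset.sum_add_distrib,
      ← Finset.sum_sub_distrib, Finset.mul_sum]
    refine Finset.sum_congr rfl fun x _ => ?_
    rcases (hp0 x).eq_or_lt with hx | hx
    · simp [← hx]
    · have hqx := hq x hx
      have h2 : Real.log 2 ≠ 0 := (Real.log_pos one_lt_two).ne'
      rw [Real.log_div (by positivity) hx.ne', Real.log_mul (by positivity) hqx.ne',
        Real.log_rpow two_pos, Real.logb, Real.logb]
      field_simp
      ring
  obtain ⟨ρ, hρ0, hρ1, hρ⟩ := exists_sum_iid_lt_le_pow p q hp0 hp1 hq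
    (c := (2 : ℝ) ^ (-r)) (by positivity)
    (by rw [hlog]; exact mul_neg_of_pos_of_neg (Real.log_pos one_lt_two) (by linarith))
  refine squeeze_zero (fun n => Finset.sum_nonneg fun s _ => ?_) hρ
    (tendsto_pow_atTop_nhds_zero_of_lt_one hρ0 hρ1)
  split_ifs
  · exact Finset.prod_nonneg fun i _ => hp0 _
  · exact le_rfl

theorem card_le_inv_of_mul_le {A : Type*} [Fintype A] (S : Finset A) {P : A → ℝ} {Q c : ℝ}
    (hc : 0 < c) (hP : ∀ x, 0 ≤ P x) (hQ : ∑ x, P x ≤ Q)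
    (hS : ∀ x ∈ S, 0 < P x ∧ c * Q ≤ P x) : (S.card : ℝ) ≤ c⁻¹ := by
  rcases S.eq_empty_or_nonempty with rfl | ⟨x, hx⟩
  · simpa using hc.le
  · have hQ0 : 0 < Q := (hS x hx).1.trans_le
      ((Finset.single_le_sum (fun y _ => hP y) (Finset.mem_univ x)).trans hQ)
    have h1 : S.card * (c * Q) ≤ Q := by
      rw [← nsmul_eq_mul]
      refine (Finset.card_nsmul_le_sum S P _ fun y hy => (hS y hy).2).trans ?_
      exact (Finset.sum_le_univ_sum_of_nonneg hP).trans hQ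
    rw [← one_div, le_div_iff₀ hc]
    refine le_of_mul_le_mul_right ?_ hQ0
    linarith

theorem le_fstMarginal {α β : Type*} [Fintype α] [Fintype β] {p : α × β → ℝ}
    (hp0 : ∀ x, 0 ≤ p x) (x : α × β) : p x ≤ fstMarginal p x.1 :=
  Finset.single_le_sum (f := fun b => p (x.1, b)) (fun _ _ => hp0 _) (Finset.mem_univ x.2)

theorem le_sndMarginal {α β : Type*} [Fintype α] [Fintype β] {p : α × β → ℝ}
    (hp0 : ∀ x, 0 ≤ p x) (x : α × β) : p x ≤ sndMarginal p x.2 :=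
  Finset.single_le_sum (f := fun a => p (a, x.2)) (fun _ _ => hp0 _) (Finset.mem_univ x.1)

theorem condEntropyFst_eq {α β : Type*} [Fintype α] [Fintype β] (p : α × β → ℝ) :
    condEntropyFst p = shannonEntropy p + ∑ x, p x * Real.logb 2 (sndMarginal p x.2) := by
  rw [condEntropyFst, shannonEntropy.eq_1 (sndMarginal p), sub_neg_eq_add,
    Fintype.sum_prod_type_right]
  simp only [sndMarginal, Finset.sum_mul]

theorem condEntropySnd_eq {α β : Type*} [Fintype α] [Fintype β] (p : α × β → ℝ) :
    condEntropySnd p = shannonEntropy p + ∑ x, p x * Real.logb 2 (fstMarginal p x.1) := by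
  rw [condEntropySnd, shannonEntropy.eq_1 (fstMarginal p), sub_neg_eq_add,
    Fintype.sum_prod_type]
  simp only [fstMarginal, Finset.sum_mul]

theorem exists_swErrorProb_le {α β : Type*} [Fintype α] [Fintype β]
    [DecidableEq α] [DecidableEq β] (p : α × β → ℝ) (hp0 : ∀ x, 0 ≤ p x)
    (hp1 : ∑ x, p x = 1) {cA cB c : ℝ} (hcA : 0 < cA) (hcB : 0 < cB) (hc : 0 < c)
    (n : ℕ) {MA MB : ℕ} (hMA : 0 < MA) (hMB : 0 < MB) :
    ∃ (fA : (Fin n → α) → Fin MA) (fB : (Fin n → β) → Fin MB)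
      (g : Fin MA × Fin MB → (Fin n → α) × (Fin n → β)),
      swErrorProb p fA fB g ≤
        ((∑ s : Fin n → α × β, (if ∏ i, p (s i) < cA ^ n * ∏ i, sndMarginal p (s i).2
            then ∏ i, p (s i) else 0)) +
          (∑ s : Fin n → α × β, (if ∏ i, p (s i) < cB ^ n * ∏ i, fstMarginal p (s i).1
            then ∏ i, p (s i) else 0)) +
          (∑ s : Fin n → α × β, (if ∏ i, p (s i) < c ^ n * ∏ _i : Fin n, (1 : ℝ)
            then ∏ i, p (s i) else 0))) +
        ((cA ^ n)⁻¹ / MA + (cB ^ n)⁻¹ / MB + (c ^ n)⁻¹ / (MA * MB)) := by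
  classical
  let e : (Fin n → α × β) ≃ (Fin n → α) × (Fin n → β) := Equiv.arrowProdEquivProdArrow _ _ _
  let P : (Fin n → α) × (Fin n → β) → ℝ := fun z => ∏ i, p (z.1 i, z.2 i)
  have hP0 (z) : 0 ≤ P z := Finset.prod_nonneg fun i _ => hp0 _
  have hsum : ∑ z, P z = 1 := by
    rw [← Fintype.sum_equiv e (fun s => ∏ i, p (s i)) P fun s => rfl, ← Fintype.sum_pow, hp1,
      one_pow]
  have hne : Nonempty ((Fin n → α) × (Fin n → β)) := by
    by_contra h
    rw [not_nonempty_iff] at h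
    simp at hsum
  let T : Finset ((Fin n → α) × (Fin n → β)) := Finset.univ.filter fun z =>
    0 < P z ∧ cA ^ n * ∏ i, sndMarginal p (z.2 i) ≤ P z ∧
      cB ^ n * ∏ i, fstMarginal p (z.1 i) ≤ P z ∧ c ^ n * ∏ _i : Fin n, (1 : ℝ) ≤ P z
  have hT {z} (hz : z ∈ T) : 0 < P z ∧ cA ^ n * ∏ i, sndMarginal p (z.2 i) ≤ P z ∧
      cB ^ n * ∏ i, fstMarginal p (z.1 i) ≤ P z ∧ c ^ n * ∏ _i : Fin n, (1 : ℝ) ≤ P z :=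
    (Finset.mem_filter.1 hz).2
  have hKA (y : Fin n → β) :
      ((Finset.univ.filter fun x => (x, y) ∈ T).card : ℝ) ≤ (cA ^ n)⁻¹ := by
    refine card_le_inv_of_mul_le (P := fun x => P (x, y)) (Q := ∏ i, sndMarginal p (y i)) _
      (by positivity) (fun _ => hP0 _) ?_ fun x hx => ?_
    · simp only [sndMarginal, P]
      rw [Fintype.prod_sum]
    · have := hT (Finset.mem_filter.1 hx).2
      exact ⟨this.1, this.2.1⟩
  have hKB (x : Fin n → α) :
      ((Finset.univ.filter fun y => (x, y) ∈ T).card : ℝ) ≤ (cB ^ n)⁻¹ := by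
    refine card_le_inv_of_mul_le (P := fun y => P (x, y)) (Q := ∏ i, fstMarginal p (x i)) _
      (by positivity) (fun _ => hP0 _) ?_ fun y hy => ?_
    · simp only [fstMarginal, P]
      rw [Fintype.prod_sum]
    · have := hT (Finset.mem_filter.1 hy).2
      exact ⟨this.1, this.2.2.1⟩
  have hK : (T.card : ℝ) ≤ (c ^ n)⁻¹ := by
    refine card_le_inv_of_mul_le (P := P) (Q := 1) _ (by positivity) hP0 hsum.le fun z hz => ?_
    have := hT hz
    simp only [Finset.prod_const_one] at this
    exact ⟨this.1, this.2.2.2⟩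
  obtain ⟨fA, fB, g, h⟩ := exists_binning_code_error_le P hP0 T hMA hMB hKA hKB hK
  refine ⟨fA, fB, g, ?_⟩
  rw [hsum, one_mul] at h
  have herr : swErrorProb p fA fB g = ∑ z, (if g (fA z.1, fB z.2) ≠ z then P z else 0) :=
    Fintype.sum_equiv e _ _ fun s => rfl
  rw [herr]
  refine h.trans (add_le_add_left ?_ _)
  rw [← Fintype.sum_equiv e (fun s => if e s ∉ T then P (e s) else 0) _ fun s => rfl,
    ← Finset.sum_add_distrib, ← Finset.sum_add_distrib]
  refine Finset.sum_le_sum fun s _ => ?_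
  have hPs : 0 ≤ ∏ i, p (s i) := hP0 (e s)
  have hmem : e s ∈ T ↔ 0 < ∏ i, p (s i) ∧ cA ^ n * ∏ i, sndMarginal p (s i).2 ≤ ∏ i, p (s i) ∧
      cB ^ n * ∏ i, fstMarginal p (s i).1 ≤ ∏ i, p (s i) ∧
      c ^ n * ∏ _i : Fin n, (1 : ℝ) ≤ ∏ i, p (s i) := by
    simp [T, P, e, Equiv.arrowProdEquivProdArrow]
  have hPe : P (e s) = ∏ i, p (s i) := rfl
  rw [hPe]
  simp only [hmem]
  split_ifs <;> grind

theorem tendsto_inv_pow_div_zero {r R : ℝ} (h : r < R) :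
    Filter.Tendsto (fun n : ℕ => (((2 : ℝ) ^ (-r)) ^ n)⁻¹ / (2 : ℝ) ^ (n * R))
      Filter.atTop (nhds 0) := by
  have : (fun n : ℕ => (((2 : ℝ) ^ (-r)) ^ n)⁻¹ / (2 : ℝ) ^ (n * R)) =
      fun n : ℕ => ((2 : ℝ) ^ (r - R)) ^ n := by
    ext n
    rw [← Real.rpow_natCast, ← Real.rpow_natCast, ← Real.rpow_mul two_pos.le,
      ← Real.rpow_mul two_pos.le, ← Real.rpow_neg two_pos.le, ← Real.rpow_sub two_pos]
    ring_nf
  rw [this]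
  exact tendsto_pow_atTop_nhds_zero_of_lt_one (by positivity)
    (Real.rpow_lt_one_of_one_lt_of_neg one_lt_two (by linarith))

/-- **Slepian–Wolf theorem (achievability part).**  Every nonnegative rate
pair `(RA, RB)` satisfying the strict inequalities `RA > H(A|B)`,
`RB > H(B|A)` and `RA + RB > H(A,B)` is achievable for lossless distributed
compression of the i.i.d. source with per-symbol joint distribution `p`:
for every `ε > 0` there exist a block length `n`, separate encoders
`fA : αⁿ → {1, …, ⌈2^{n RA}⌉}` and `fB : βⁿ → {1, …, ⌈2^{n RB}⌉}`, and a
joint decoder `g` whose block error probability is at most `ε`. -/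
theorem slepian_wolf_achievability {α β : Type*} [Fintype α] [Fintype β]
    [DecidableEq α] [DecidableEq β]
    (p : α × β → ℝ) (hp0 : ∀ x, 0 ≤ p x) (hp1 : ∑ x, p x = 1)
    {RA RB : ℝ} (hRA : 0 ≤ RA) (hRB : 0 ≤ RB)
    (h1 : condEntropyFst p < RA) (h2 : condEntropySnd p < RB)
    (h3 : shannonEntropy p < RA + RB) :
    SWAchievable p RA RB := by
  obtain ⟨rA, hrA, hrA'⟩ := exists_between h1
  obtain ⟨rB, hrB, hrB'⟩ := exists_between h2
  obtain ⟨r, hr, hr'⟩ := exists_between h3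
  rw [condEntropyFst_eq] at hrA
  rw [condEntropySnd_eq] at hrB
  have tA := tendsto_sum_iid_lt_zero p (fun x => sndMarginal p x.2) hp0 hp1
    (fun x hx => hx.trans_le (le_sndMarginal hp0 x)) hrA
  have tB := tendsto_sum_iid_lt_zero p (fun x => fstMarginal p x.1) hp0 hp1
    (fun x hx => hx.trans_le (le_fstMarginal hp0 x)) hrB
  have t := tendsto_sum_iid_lt_zero p (fun _ => 1) hp0 hp1 (fun _ _ => one_pos)
    (r := r) (by simpa using hr)
  have key := ((tA.add tB).add t).add (((tendsto_inv_pow_div_zero hrA').add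
    (tendsto_inv_pow_div_zero hrB')).add (tendsto_inv_pow_div_zero hr'))
  simp only [add_zero] at key
  intro ε hε
  obtain ⟨n, hn, hn0⟩ :=
    ((key.eventually_lt_const hε).and (Filter.eventually_gt_atTop 0)).exists
  have hM (R : ℝ) : 0 < ⌈(2 : ℝ) ^ ((n : ℝ) * R)⌉₊ := Nat.ceil_pos.2 (by positivity)
  obtain ⟨fA, fB, g, h⟩ := exists_swErrorProb_le p hp0 hp1 (cA := (2 : ℝ) ^ (-rA))
    (cB := (2 : ℝ) ^ (-rB)) (c := (2 : ℝ) ^ (-r)) (by positivity) (by positivity)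
    (by positivity) n (hM RA) (hM RB)
  refine ⟨n, hn0, fA, fB, g, h.trans (le_trans ?_ hn.le)⟩
  rw [mul_add (n : ℝ) RA RB, Real.rpow_add two_pos]
  gcongr <;> exact Nat.le_ceil _
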